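/- Affine Lagrangian relations are closed under relational composition up to the empty relation: let k be a field and a, b, c ∈ ℕ. If L₁ ⊆ k^{2a} × k^{2b} and L₂ ⊆ k^{2b} × k^{2c} are nonempty affine subspaces whose directions are Lagrangian subspaces for the twisted forms Ω_{a,b} and Ω_{b,c} respectively, then the relational composite L₂ ∘ L₁ := {(u,w) : ∃ v ∈ k^{2b}, (u,v) ∈ L₁ and (v,w) ∈ L₂} is either empty or a nonempty affine subspace of k^{2a} × k^{2c} whose direction is Lagrangian for Ω_{a,c}. (This is the well-definedness of composition in the prop of affine Lagrangian relations Aff Lag Rel_k.) -/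

import Mathlib

open Matrix

/-- Points of `k^{2n} = k^n × k^n`, written as pairs `(z, x)` of a Z-grading
and an X-grading. -/
abbrev PVec (k : Type*) (n : ℕ) := (Fin n → k) × (Fin n → k)

/-- The standard symplectic form on `k^{2n}`:
`ω_n((z,x),(z',x')) = z·x' − x·z'`. -/
def stdForm {k : Type*} [Field k] (n : ℕ) (v w : PVec k n) : k :=
  v.1 ⬝ᵥ w.2 - v.2 ⬝ᵥ w.1

/-- The twisted symplectic form on `k^{2m} × k^{2n}`:
`Ω_{m,n}((u,v),(u',v')) = ω_n(v,v') − ω_m(u,u')`. -/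
def twForm {k : Type*} [Field k] (m n : ℕ) (p q : PVec k m × PVec k n) : k :=
  stdForm n p.2 q.2 - stdForm m p.1 q.1

/-- The symplectic complement of a set `S` with respect to a form `ω`. -/
def sympComplSet {k X : Type*} [Zero k] (ω : X → X → k) (S : Set X) : Set X :=
  {x | ∀ u ∈ S, ω x u = 0}

/-- A submodule is isotropic when it is contained in its symplectic complement. -/
def IsIsotropic {k X : Type*} [Field k] [AddCommGroup X] [Module k X]
    (ω : X → X → k) (U : Submodule k X) : Prop :=
  (U : Set X) ⊆ sympComplSet ω (U : Set X)

/-- A submodule is coisotropic when it contains its symplectic complement. -/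
def IsCoisotropic {k X : Type*} [Field k] [AddCommGroup X] [Module k X]
    (ω : X → X → k) (U : Submodule k X) : Prop :=
  sympComplSet ω (U : Set X) ⊆ (U : Set X)

/-- A submodule is Lagrangian when it equals its symplectic complement. -/
def IsLagrangian {k X : Type*} [Field k] [AddCommGroup X] [Module k X]
    (ω : X → X → k) (U : Submodule k X) : Prop :=
  (U : Set X) = sympComplSet ω (U : Set X)

/-- Relational composition of set relations (first `R`, then `S`), i.e. `S ∘ R`. -/
def scomp {A B C : Type*} (R : Set (A × B)) (S : Set (B × C)) : Set (A × C) :=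
  {p | ∃ v : B, (p.1, v) ∈ R ∧ (v, p.2) ∈ S}

/-- The standard symplectic form with its first argument fixed, as a linear functional. -/
def stdFormRight {k : Type*} [Field k] (n : ℕ) (v : PVec k n) : PVec k n →ₗ[k] k where
  toFun := stdForm n v
  map_add' x y := by
    simp only [stdForm, Prod.fst_add, Prod.snd_add, dotProduct_add]
    ring
  map_smul' r x := by
    simp only [stdForm, Prod.smul_fst, Prod.smul_snd, dotProduct_smul, smul_eq_mul,
      RingHom.id_apply]
    ring

@[simp]
theorem stdFormRight_apply {k : Type*} [Field k] (n : ℕ) (v w : PVec k n) :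
    stdFormRight n v w = stdForm n v w := rfl

/-- Every linear functional is represented by the standard symplectic form. -/
theorem exists_stdForm_eq {k : Type*} [Field k] (n : ℕ) (ψ : PVec k n →ₗ[k] k) :
    ∃ v : PVec k n, ∀ x, stdForm n v x = ψ x := by
  refine ⟨(fun i => ψ (0, Pi.single i 1), fun i => -ψ (Pi.single i 1, 0)), fun x => ?_⟩
  suffices h : stdFormRight n
      (fun i => ψ (0, Pi.single i 1), fun i => -ψ (Pi.single i 1, 0)) = ψ from
    LinearMap.congr_fun h x
  ext i <;> simp [stdForm]

/-- A linear functional vanishing on the kernel of a linear map factors through that map. -/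
theorem exists_comp_eq_of_ker_le {k V W : Type*} [Field k] [AddCommGroup V] [Module k V]
    [AddCommGroup W] [Module k W] (T : V →ₗ[k] W) (φ : V →ₗ[k] k)
    (h : LinearMap.ker T ≤ LinearMap.ker φ) : ∃ ψ : W →ₗ[k] k, ψ ∘ₗ T = φ := by
  have hφ : φ ∈ LinearMap.range T.dualMap := by
    rw [LinearMap.range_dualMap_eq_dualAnnihilator_ker, Submodule.mem_dualAnnihilator]
    exact fun x hx => h hx
  exact hφ

/-- The relational composite of two linear relations. -/
def linComp {k U V W : Type*} [Field k] [AddCommGroup U] [Module k U] [AddCommGroup V]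
    [Module k V] [AddCommGroup W] [Module k W] (D₁ : Submodule k (U × V))
    (D₂ : Submodule k (V × W)) : Submodule k (U × W) where
  carrier := scomp (D₁ : Set (U × V)) (D₂ : Set (V × W))
  zero_mem' := ⟨0, D₁.zero_mem, D₂.zero_mem⟩
  add_mem' := by
    rintro p q ⟨v, h₁, h₂⟩ ⟨v', h₁', h₂'⟩
    exact ⟨v + v', D₁.add_mem h₁ h₁', D₂.add_mem h₂ h₂'⟩
  smul_mem' := by
    rintro r p ⟨v, h₁, h₂⟩
    exact ⟨r • v, D₁.smul_mem r h₁, D₂.smul_mem r h₂⟩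

theorem IsLagrangian.mem_iff {k X : Type*} [Field k] [AddCommGroup X] [Module k X]
    {ω : X → X → k} {U : Submodule k X} (h : IsLagrangian ω U) {x : X} :
    x ∈ U ↔ ∀ u ∈ U, ω x u = 0 :=
  Set.ext_iff.mp h x

/-- Linear Lagrangian relations are closed under relational composition. -/
theorem IsLagrangian.linComp {k : Type*} [Field k] {a b c : ℕ}
    {D₁ : Submodule k (PVec k a × PVec k b)} {D₂ : Submodule k (PVec k b × PVec k c)}
    (hD₁ : IsLagrangian (twForm a b) D₁) (hD₂ : IsLagrangian (twForm b c) D₂) :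
    IsLagrangian (twForm a c) (linComp D₁ D₂) := by
  apply Set.Subset.antisymm
  · rintro ⟨u, w⟩ ⟨v, h₁, h₂⟩ ⟨u', w'⟩ ⟨v', h₁', h₂'⟩
    have e₁ := hD₁.mem_iff.mp h₁ _ h₁'
    have e₂ := hD₂.mem_iff.mp h₂ _ h₂'
    simp only [twForm] at e₁ e₂ ⊢
    linear_combination e₁ + e₂
  · rintro ⟨u, w⟩ h
    let T : (D₁ × D₂) →ₗ[k] PVec k b :=
      (LinearMap.snd k _ _ ∘ₗ D₁.subtype).coprod (LinearMap.fst k _ _ ∘ₗ D₂.subtype)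
    let φ : (D₁ × D₂) →ₗ[k] k :=
      (stdFormRight a u ∘ₗ LinearMap.fst k _ _ ∘ₗ D₁.subtype).coprod
        (stdFormRight c w ∘ₗ LinearMap.snd k _ _ ∘ₗ D₂.subtype)
    have hker : LinearMap.ker T ≤ LinearMap.ker φ := by
      rintro ⟨⟨⟨u', v'⟩, h₁⟩, ⟨⟨v'', w'⟩, h₂⟩⟩ hT
      have hv : v' + v'' = 0 := hT
      obtain rfl : v' = -v'' := eq_neg_of_add_eq_zero_left hv
      have hmem : (u', -w') ∈ _root_.linComp D₁ D₂ := ⟨-v'', h₁, D₂.neg_mem h₂⟩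
      have e : stdFormRight c w (-w') - stdFormRight a u u' = 0 := h _ hmem
      rw [map_neg] at e
      change stdFormRight a u u' + stdFormRight c w w' = 0
      linear_combination -e
    obtain ⟨ψ, hψ⟩ := exists_comp_eq_of_ker_le T φ hker
    obtain ⟨v, hv⟩ := exists_stdForm_eq b ψ
    refine ⟨v, hD₁.mem_iff.mpr fun p hp => ?_, hD₂.mem_iff.mpr fun p hp => ?_⟩
    · have e := LinearMap.congr_fun hψ (⟨p, hp⟩, 0)
      simp only [T, φ, LinearMap.comp_apply, LinearMap.coprod_apply, map_zero, add_zero,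
        Submodule.subtype_apply, LinearMap.fst_apply, LinearMap.snd_apply,
        stdFormRight_apply, ← hv] at e
      simp only [twForm, e, sub_self]
    · have e := LinearMap.congr_fun hψ (0, ⟨p, hp⟩)
      simp only [T, φ, LinearMap.comp_apply, LinearMap.coprod_apply, map_zero, zero_add,
        Submodule.subtype_apply, LinearMap.fst_apply, LinearMap.snd_apply,
        stdFormRight_apply, ← hv] at e
      simp only [twForm, e, sub_self]

/-- Membership in an affine subspace is tested by the difference to any of its points. -/
theorem mem_affine_iff_sub_mem {k X : Type*} [Field k] [AddCommGroup X] [Module k X]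
    {L : Set X} {D : Submodule k X} (hL : ∃ p, L = (fun d => p + d) '' (D : Set X))
    {q : X} (hq : q ∈ L) (x : X) : x ∈ L ↔ x - q ∈ D := by
  obtain ⟨p, rfl⟩ := hL
  obtain ⟨d, hd, rfl⟩ := hq
  constructor
  · rintro ⟨d', hd', rfl⟩
    simpa using D.sub_mem hd' hd
  · intro h
    exact ⟨x - (p + d) + d, D.add_mem h hd, by beta_reduce; abel⟩

/-- Affine Lagrangian relations are closed under relational composition up to
the empty relation: the composite of two nonempty affine relations with
Lagrangian directions is either empty or a nonempty affine relation whose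
direction is Lagrangian. -/
theorem affine_lagrangian_relations_comp {k : Type*} [Field k] (a b c : ℕ)
    (L₁ : Set (PVec k a × PVec k b)) (D₁ : Submodule k (PVec k a × PVec k b))
    (h₁ : ∃ p₁ : PVec k a × PVec k b,
      L₁ = (fun d => p₁ + d) '' (D₁ : Set (PVec k a × PVec k b)))
    (hD₁ : IsLagrangian (twForm a b) D₁)
    (L₂ : Set (PVec k b × PVec k c)) (D₂ : Submodule k (PVec k b × PVec k c))
    (h₂ : ∃ p₂ : PVec k b × PVec k c,
      L₂ = (fun d => p₂ + d) '' (D₂ : Set (PVec k b × PVec k c)))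
    (hD₂ : IsLagrangian (twForm b c) D₂) :
    scomp L₁ L₂ = ∅ ∨
      ∃ (D : Submodule k (PVec k a × PVec k c)) (p : PVec k a × PVec k c),
        scomp L₁ L₂ = (fun d => p + d) '' (D : Set (PVec k a × PVec k c)) ∧
        IsLagrangian (twForm a c) D := by
  rcases (scomp L₁ L₂).eq_empty_or_nonempty with h | ⟨⟨u₀, w₀⟩, v₀, hq₁, hq₂⟩
  · exact Or.inl h
  refine Or.inr ⟨linComp D₁ D₂, (u₀, w₀), ?_, hD₁.linComp hD₂⟩
  have m₁ := mem_affine_iff_sub_mem h₁ hq₁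
  have m₂ := mem_affine_iff_sub_mem h₂ hq₂
  ext ⟨u, w⟩
  constructor
  · rintro ⟨v, hv₁, hv₂⟩
    exact ⟨(u - u₀, w - w₀), ⟨v - v₀, (m₁ _).mp hv₁, (m₂ _).mp hv₂⟩, by simp⟩
  · rintro ⟨⟨u', w'⟩, ⟨v', hv₁, hv₂⟩, h⟩
    obtain ⟨rfl, rfl⟩ := Prod.mk.inj h
    exact ⟨v₀ + v', (m₁ _).mpr (by simpa using hv₁), (m₂ _).mpr (by simpa using hv₂)⟩
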